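/- arXiv:2011.07014 — 6 statements merged into one kernel-verified Lean document; each statement's English description precedes it below -/
import Mathlib

section
/- Let E be a complex Banach space, (Ω,Σ,μ) a σ-finite measure space with μ ≠ 0, 1 ≤ p ≤ ∞, and T a bounded operator on E. Then for every λ ∈ ℂ the following are equivalent: (i) there exists x ∈ E with x ≠ 0 and Tx = λx; (ii) there exists f ∈ L^p(Ω,μ;E) with f ≠ 0 and 𝓜_T f = λ f. In other words, the point spectra of T and of 𝓜_T coincide: σ_p(T) = σ_p(𝓜_T). -/
open MeasureTheory
open scoped ENNReal

/-- For a bounded operator `T` on a complex Banach space `E`, a nonzero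
σ-finite measure `μ` and `1 ≤ p ≤ ∞`, a complex number `λ` is an eigenvalue of `T` if and
only if it is an eigenvalue of the multiplication operator `𝓜_T` on `L^p(Ω, μ; E)`:
the point spectra of `T` and `𝓜_T` coincide. -/
theorem point_spectrum_mulOp
    {Ω E : Type*} [MeasurableSpace Ω] {μ : Measure Ω} [SigmaFinite μ] (hμ : μ ≠ 0)
    [NormedAddCommGroup E] [NormedSpace ℂ E] [CompleteSpace E]
    {p : ℝ≥0∞} [Fact (1 ≤ p)]
    (T : E →L[ℂ] E) (l : ℂ) :
    (∃ x : E, x ≠ 0 ∧ T x = l • x) ↔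
    (∃ f : Lp E p μ, f ≠ 0 ∧ T.compLpL p μ f = l • f) := by
  constructor
  · rintro ⟨x, hx, hTx⟩
    obtain ⟨s, hs, -, hs_pos, hs_fin⟩ :=
      Measure.exists_subset_measure_lt_top MeasurableSet.univ (Measure.measure_univ_pos.2 hμ)
    refine ⟨indicatorConstLp p hs hs_fin.ne x, fun h => ?_, ?_⟩
    · refine hs_pos.ne' (measure_eq_zero_iff_ae_notMem.2 ?_)
      filter_upwards [indicatorConstLp_coeFn_mem (p := p) (hs := hs) (hμs := hs_fin.ne) (c := x),
        (Lp.eq_zero_iff_ae_eq_zero).1 h] with a ha h0 has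
      exact hx ((ha has).symm.trans h0)
    · refine Lp.ext ?_
      filter_upwards [T.coeFn_compLpL (indicatorConstLp p hs hs_fin.ne x),
        Lp.coeFn_smul l (indicatorConstLp p hs hs_fin.ne x),
        indicatorConstLp_coeFn (p := p) (hs := hs) (hμs := hs_fin.ne) (c := x)] with a hT hl ha
      rw [hT, hl, Pi.smul_apply, ha]
      by_cases has : a ∈ s <;> simp [has, hTx]
  · rintro ⟨f, hf, hTf⟩
    by_contra! hx
    refine hf ((Lp.eq_zero_iff_ae_eq_zero).2 ?_)
    filter_upwards [T.coeFn_compLpL f, Lp.coeFn_smul l f] with a hT hl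
    by_contra ha
    exact hx (f a) ha (by rw [← hT, hTf, hl, Pi.smul_apply])
end

section
/- Let E be a complex Banach space, (Ω,Σ,μ) a σ-finite measure space with μ ≠ 0, 1 ≤ p ≤ ∞, T a bounded operator on E, λ ∈ ℂ, and k ∈ ℕ with k ≥ 1. Then λ is a pole of order k of the resolvent of T if and only if λ is a pole of order k of the resolvent of the multiplication operator 𝓜_T on L^p(Ω,μ;E). -/
open MeasureTheory
open scoped ENNReal

/-- `λ` is a pole of order `k` of the resolvent of `S`: there is `r > 0` such that the
punctured disc of radius `r` around `λ` lies in the resolvent set of `S`, the function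
`z ↦ (z − λ)^k • R(z, S)` extends to an analytic function on the whole disc, and the value
of this extension at `λ` is nonzero. -/
def IsResolventPoleOfOrder {A : Type*} [NormedRing A] [NormedAlgebra ℂ A]
    (S : A) (l : ℂ) (k : ℕ) : Prop :=
  ∃ r > (0 : ℝ),
    (∀ z : ℂ, z ≠ l → dist z l < r → z ∈ resolventSet ℂ S) ∧
    ∃ g : ℂ → A, AnalyticOnNhd ℂ g (Metric.ball l r) ∧
      (∀ z ∈ Metric.ball l r, z ≠ l → g z = (z - l) ^ k • resolvent S z) ∧
      g l ≠ 0

theorem map_resolvent_of_mem_resolventSet {A B : Type*} [NormedRing A] [NormedAlgebra ℂ A]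
    [NormedRing B] [NormedAlgebra ℂ B] (Φ : A →ₐ[ℂ] B) {a : A} {z : ℂ}
    (hz : z ∈ resolventSet ℂ a) : Φ (resolvent a z) = resolvent (Φ a) z := by
  obtain ⟨u, hu⟩ := spectrum.mem_resolventSet_iff.mp hz
  have hu' : algebraMap ℂ B z - Φ a = (Units.map (Φ : A →* B) u : Bˣ) := by
    simp [hu]
  rw [resolvent, resolvent, ← hu, hu', Ring.inverse_unit, Ring.inverse_unit]
  simp [← map_inv]

/-- A continuous unital homomorphism that reflects invertibility and has a continuous linear
left inverse preserves and reflects the poles of the resolvent. -/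
theorem isResolventPoleOfOrder_map_iff {A B : Type*} [NormedRing A] [NormedAlgebra ℂ A]
    [NormedRing B] [NormedAlgebra ℂ B] (Φ : A →ₐ[ℂ] B) (hΦ : Continuous Φ) (P : B →L[ℂ] A)
    (hP : ∀ a, P (Φ a) = a) (hunit : ∀ a, IsUnit (Φ a) → IsUnit a) (a : A) (l : ℂ) (k : ℕ) :
    IsResolventPoleOfOrder a l k ↔ IsResolventPoleOfOrder (Φ a) l k := by
  have hmem (z : ℂ) : z ∈ resolventSet ℂ a ↔ z ∈ resolventSet ℂ (Φ a) := by
    simp only [spectrum.mem_resolventSet_iff]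
    have h : algebraMap ℂ B z - Φ a = Φ (algebraMap ℂ A z - a) := by simp
    rw [h]
    exact ⟨fun h ↦ h.map Φ, hunit _⟩
  constructor
  · rintro ⟨r, hr, hres, g, hg, hgr, hgl⟩
    let ΦL : A →L[ℂ] B := ⟨Φ.toLinearMap, hΦ⟩
    refine ⟨r, hr, fun z hz hzr ↦ (hmem z).1 (hres z hz hzr), fun z ↦ ΦL (g z),
      fun z hz ↦ (ΦL.analyticAt _).comp (hg z hz), fun z hz hzl ↦ ?_, fun h ↦ hgl ?_⟩
    · beta_reduce
      rw [hgr z hz hzl, map_smul]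
      congr 1
      exact map_resolvent_of_mem_resolventSet Φ (hres z hzl hz)
    · rw [← hP (g l)]
      exact (congrArg P h).trans (map_zero P)
  · rintro ⟨r, hr, hres, g, hg, hgr, hgl⟩
    have hPg (z : ℂ) (hz : z ∈ Metric.ball l r) (hzl : z ≠ l) :
        P (g z) = (z - l) ^ k • resolvent a z := by
      rw [hgr z hz hzl, map_smul,
        ← map_resolvent_of_mem_resolventSet Φ ((hmem z).2 (hres z hzl hz)), hP]
    refine ⟨r, hr, fun z hz hzr ↦ (hmem z).2 (hres z hz hzr), fun z ↦ P (g z),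
      fun z hz ↦ (P.analyticAt _).comp (hg z hz), hPg, fun h ↦ hgl ?_⟩
    have hball : Metric.ball l r ∈ nhds l := Metric.ball_mem_nhds l hr
    have hcont : ContinuousAt g l := (hg l (mem_of_mem_nhds hball)).continuousAt
    have hcont' : ContinuousAt (fun z ↦ Φ (P (g z))) l :=
      hΦ.continuousAt.comp (P.continuous.continuousAt.comp hcont)
    have heq : (fun z ↦ Φ (P (g z))) =ᶠ[nhdsWithin l {l}ᶜ] g := by
      filter_upwards [nhdsWithin_le_nhds hball, self_mem_nhdsWithin] with z hz hzl
      rw [hPg z hz hzl, hgr z hz hzl, map_smul,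
        map_resolvent_of_mem_resolventSet Φ ((hmem z).2 (hres z hzl hz))]
    have hlim := tendsto_nhds_unique (hcont'.tendsto.mono_left nhdsWithin_le_nhds)
      ((hcont.tendsto.mono_left nhdsWithin_le_nhds).congr' heq.symm)
    rw [← hlim]
    exact (congrArg Φ h).trans (map_zero Φ)

section MulOp

variable {Ω E : Type*} [MeasurableSpace Ω] (μ : Measure Ω)
  [NormedAddCommGroup E] [NormedSpace ℂ E] (p : ℝ≥0∞) [Fact (1 ≤ p)]

/-- The unital homomorphism sending a bounded operator to its multiplication operator
on `L^p`. -/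
noncomputable def mulOpAlgHom : (E →L[ℂ] E) →ₐ[ℂ] (Lp E p μ →L[ℂ] Lp E p μ) :=
  AlgHom.ofLinearMap
    { toFun := fun T ↦ T.compLpL p μ
      map_add' := fun S T ↦ S.add_compLpL T
      map_smul' := fun c T ↦ T.smul_compLpL c }
    (by
      ext f
      exact ContinuousLinearMap.coeFn_compLpL _ f)
    (fun S T ↦ by
      ext f
      change (S * T).compLpL p μ f =ᵐ[μ] S.compLpL p μ (T.compLpL p μ f)
      filter_upwards [(S * T).coeFn_compLpL f, S.coeFn_compLpL (T.compLpL p μ f),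
        T.coeFn_compLpL f] with ω h₁ h₂ h₃
      rw [h₁, h₂, h₃, mul_apply_eq_comp])

theorem mulOpAlgHom_apply (T : E →L[ℂ] E) : mulOpAlgHom μ p T = T.compLpL p μ := rfl

theorem continuous_mulOpAlgHom : Continuous (mulOpAlgHom (E := E) μ p) :=
  AddMonoidHomClass.continuous_of_bound (mulOpAlgHom μ p) 1 fun T ↦ by
    simpa [mulOpAlgHom_apply] using T.norm_compLpL_le (p := p) (μ := μ)

variable {μ} {s : Set Ω} (hs : MeasurableSet s) (hμs : μ s ≠ ∞)

/-- The embedding of `E` into `L^p` as multiples of the indicator function of `s`. -/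
noncomputable def indicatorConstCLM : E →L[ℂ] Lp E p μ :=
  ((ContinuousLinearMap.lsmul ℂ ℂ (E := E)).flip.compLpL₂ p μ).flip (indicatorConstLp p hs hμs 1)

theorem coeFn_indicatorConstCLM (x : E) :
    indicatorConstCLM p hs hμs x =ᵐ[μ] s.indicator fun _ ↦ x := by
  filter_upwards [((ContinuousLinearMap.lsmul ℂ ℂ (E := E)).flip x).coeFn_compLpL
      (indicatorConstLp p hs hμs 1),
    indicatorConstLp_coeFn (p := p) (hs := hs) (hμs := hμs) (c := (1 : ℂ))] with ω h₁ h₂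
  refine h₁.trans ?_
  by_cases hω : ω ∈ s <;> simp [h₂, hω]

/-- The mean value over `s`, as an operator from `L^p` to `E`. -/
noncomputable def averageCLM [CompleteSpace E] : Lp E p μ →L[ℂ] E :=
  haveI : ENNReal.HolderConjugate (ENNReal.conjExponent p) p :=
    (ENNReal.HolderConjugate.conjExponent Fact.out).symm
  haveI : Fact (1 ≤ ENNReal.conjExponent p) := ⟨ENNReal.HolderConjugate.one_le _ p⟩
  (ContinuousLinearMap.lsmul ℂ ℂ (E := E)).lpPairing μ (ENNReal.conjExponent p) p
    (indicatorConstLp (ENNReal.conjExponent p) hs hμs (μ.real s : ℂ)⁻¹)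

theorem averageCLM_apply_of_ae_eq [CompleteSpace E] (hs₀ : μ s ≠ 0) {f : Lp E p μ} {x : E}
    (hf : ∀ᵐ ω ∂μ, ω ∈ s → f ω = x) : averageCLM p hs hμs f = x := by
  have : ENNReal.HolderConjugate (ENNReal.conjExponent p) p :=
    (ENNReal.HolderConjugate.conjExponent Fact.out).symm
  have : Fact (1 ≤ ENNReal.conjExponent p) := ⟨ENNReal.HolderConjugate.one_le _ p⟩
  have hne : (μ.real s : ℂ) ≠ 0 := by
    exact_mod_cast (measureReal_ne_zero_iff hμs).2 hs₀
  have hae : (fun ω ↦ ContinuousLinearMap.lsmul ℂ ℂ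
      (indicatorConstLp (ENNReal.conjExponent p) hs hμs (μ.real s : ℂ)⁻¹ ω) (f ω)) =ᵐ[μ]
      s.indicator fun _ ↦ (μ.real s : ℂ)⁻¹ • x := by
    filter_upwards [hf, indicatorConstLp_coeFn (p := ENNReal.conjExponent p) (hs := hs)
      (hμs := hμs) (c := (μ.real s : ℂ)⁻¹)] with ω h₁ h₂
    by_cases hω : ω ∈ s <;> simp [h₂, hω, h₁]
  rw [averageCLM, ContinuousLinearMap.lpPairing_eq_integral, integral_congr_ae hae,
    integral_indicator_const _ hs, ← Complex.coe_smul, smul_smul, mul_inv_cancel₀ hne, one_smul]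

theorem averageCLM_compLpL_indicatorConstCLM [CompleteSpace E] (hs₀ : μ s ≠ 0) (T : E →L[ℂ] E)
    (x : E) : averageCLM p hs hμs (T.compLpL p μ (indicatorConstCLM p hs hμs x)) = T x := by
  refine averageCLM_apply_of_ae_eq p hs hμs hs₀ ?_
  filter_upwards [T.coeFn_compLpL (indicatorConstCLM p hs hμs x),
    coeFn_indicatorConstCLM p hs hμs x] with ω h₁ h₂ hω
  rw [h₁, h₂, Set.indicator_of_mem hω]

/-- An operator is invertible as soon as its multiplication operator is: it is injective because
`x ↦ 𝟙_s x` is, and surjective because `𝓜_T f = 𝟙_s y` gives `T (f ω) = y` for some `ω ∈ s`. -/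
theorem isUnit_of_isUnit_compLpL [CompleteSpace E] (hs : MeasurableSet s) (hμs : μ s ≠ ∞)
    (hs₀ : μ s ≠ 0) {T : E →L[ℂ] E} (hT : IsUnit (T.compLpL p μ)) : IsUnit T := by
  rw [ContinuousLinearMap.isUnit_iff_bijective] at hT ⊢
  have hfreq : ∃ᵐ ω ∂μ, ω ∈ s := frequently_ae_mem_iff.2 hs₀
  constructor
  · rw [injective_iff_map_eq_zero]
    intro x hx
    have h : T.compLpL p μ (indicatorConstCLM p hs hμs x) = T.compLpL p μ 0 := by
      rw [map_zero]
      refine Lp.ext (Filter.EventuallyEq.trans ?_ (Lp.coeFn_zero E p μ).symm)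
      filter_upwards [T.coeFn_compLpL (indicatorConstCLM p hs hμs x),
        coeFn_indicatorConstCLM p hs hμs x] with ω h₁ h₂
      by_cases hω : ω ∈ s <;> simp [h₁, h₂, hω, hx]
    obtain ⟨ω, hω, h₁, h₂⟩ := (hfreq.and_eventually
      ((coeFn_indicatorConstCLM p hs hμs x).and (Lp.coeFn_zero E p μ))).exists
    rw [← Set.indicator_of_mem hω fun _ ↦ x, ← h₁, hT.1 h, h₂, Pi.zero_apply]
  · intro y
    obtain ⟨f, hf⟩ := hT.2 (indicatorConstCLM p hs hμs y)
    obtain ⟨ω, hω, h₁, h₂⟩ := (hfreq.and_eventually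
      ((T.coeFn_compLpL f).and (coeFn_indicatorConstCLM p hs hμs y))).exists
    exact ⟨f ω, h₁.symm.trans (by rw [hf, h₂, Set.indicator_of_mem hω])⟩

/-- Compressing an operator on `L^p` to the multiples of `𝟙_s` recovers `T` from `𝓜_T`. -/
theorem exists_leftInverse_compLpL [CompleteSpace E] (hs : MeasurableSet s) (hμs : μ s ≠ ∞)
    (hs₀ : μ s ≠ 0) :
    ∃ P : (Lp E p μ →L[ℂ] Lp E p μ) →L[ℂ] (E →L[ℂ] E), ∀ T : E →L[ℂ] E,
      P (T.compLpL p μ) = T := by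
  refine ⟨(ContinuousLinearMap.compL ℂ E (Lp E p μ) E (averageCLM p hs hμs)) ∘L
    (ContinuousLinearMap.compL ℂ E (Lp E p μ) (Lp E p μ)).flip (indicatorConstCLM p hs hμs),
    fun T ↦ ?_⟩
  ext x
  simp only [ContinuousLinearMap.comp_apply, ContinuousLinearMap.flip_apply,
    ContinuousLinearMap.compL_apply]
  exact averageCLM_compLpL_indicatorConstCLM p hs hμs hs₀ T x

end MulOp

/-- For a bounded operator `T` on a complex Banach space `E`, a nonzero
σ-finite measure `μ`, `1 ≤ p ≤ ∞`, `λ ∈ ℂ` and `k ≥ 1`: `λ` is a pole of order `k` of the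
resolvent of `T` if and only if `λ` is a pole of order `k` of the resolvent of the
multiplication operator `𝓜_T` on `L^p(Ω, μ; E)`. -/
theorem resolvent_pole_iff_mulOp
    {Ω E : Type*} [MeasurableSpace Ω] {μ : Measure Ω} [SigmaFinite μ] (hμ : μ ≠ 0)
    [NormedAddCommGroup E] [NormedSpace ℂ E] [CompleteSpace E]
    {p : ℝ≥0∞} [Fact (1 ≤ p)]
    (T : E →L[ℂ] E) (l : ℂ) (k : ℕ) (hk : 1 ≤ k) :
    IsResolventPoleOfOrder T l k ↔ IsResolventPoleOfOrder (T.compLpL p μ) l k := by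
  obtain ⟨s, hs, -, hs₀, hμs⟩ := Measure.exists_subset_measure_lt_top (μ := μ) (r := 0)
    MeasurableSet.univ (Measure.measure_univ_pos.2 hμ)
  obtain ⟨P, hP⟩ := exists_leftInverse_compLpL (E := E) p hs hμs.ne hs₀.ne'
  have h := isResolventPoleOfOrder_map_iff (mulOpAlgHom (E := E) μ p) (continuous_mulOpAlgHom μ p)
    P hP (fun S ↦ isUnit_of_isUnit_compLpL p hs hμs.ne hs₀.ne') T l k
  rwa [mulOpAlgHom_apply] at h
end

section
/- Let b : ℕ → ℕ → ℝ be a column-stochastic matrix (b i j ≥ 0, ∑_i b i j = 1 for all j) inducing the bounded operator B on ℓ¹ = ℓ¹(ℕ;ℝ). Let λ > 0 and let f : [0,1] → ℓ¹ be a bounded strongly measurable function. Define g : [0,1] → ℓ¹ by g(s) := ∑_{n=0}^∞ e^{−λn} ∫₀¹ e^{−λ(t+1−s)} B^{n+1}(f(t)) dt + ∫_s¹ e^{λ(s−t)} f(t) dt, where the integrals are Bochner integrals and the series converges absolutely in ℓ¹ for every s ∈ [0,1]. Then: (a) g is Lipschitz continuous on [0,1]; (b) g(1) = B(g(0)); (c)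 for almost every s ∈ (0,1), g is differentiable at s with derivative g′(s) = λ·g(s) − f(s). (Thus g is the resolvent R(λ,A)f for the generator A = d/dx with domain {g ∈ W^{1,∞}([0,1];ℓ¹) : g(1) = B g(0)} of the flow semigroup on L^∞([0,1];ℓ¹).) -/
open MeasureTheory
open scoped ENNReal NNReal

section ResolventFormula

variable {E : Type*} [NormedAddCommGroup E] [NormedSpace ℝ E]

/-- A bounded strongly measurable function on `[0,1]`, damped by `exp (-l t)`, is integrable. -/
theorem intervalIntegrable_exp_smul_of_bounded {f : ℝ → E} (hf : StronglyMeasurable f) {C : ℝ}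
    (hC : ∀ t ∈ Set.Icc (0:ℝ) 1, ‖f t‖ ≤ C) (l : ℝ) :
    IntervalIntegrable (fun t => Real.exp (-(l * t)) • f t) volume 0 1 := by
  have hfi : IntervalIntegrable f volume 0 1 := by
    rw [intervalIntegrable_iff, Set.uIoc_of_le zero_le_one]
    refine Measure.integrableOn_of_bounded (by simp) hf.aestronglyMeasurable (M := C) ?_
    filter_upwards [ae_restrict_mem measurableSet_Ioc] with t ht
    exact hC t (Set.Ioc_subset_Icc_self ht)
  exact hfi.continuousOn_smul (by fun_prop)

theorem setIntegral_Icc_exp_smul_eq (f : ℝ → E) (l : ℝ) {s : ℝ} (hs : s ≤ 1) :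
    ∫ t in Set.Icc s 1, Real.exp (l * (s - t)) • f t =
      Real.exp (l * s) • ∫ t in s..1, Real.exp (-(l * t)) • f t := by
  rw [integral_Icc_eq_integral_Ioc, ← intervalIntegral.integral_of_le hs,
    ← intervalIntegral.integral_smul]
  refine intervalIntegral.integral_congr fun t _ => ?_
  simp only [smul_smul, ← Real.exp_add]
  ring_nf

/-- If `u n = (exp (-l) B) ^ (n + 1) J` is summable with sum `W`, then `exp l • W = B (W + J)`. -/
theorem exp_smul_tsum_eq_map_tsum_add (B : E →L[ℝ] E) (l : ℝ) (J : E)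
    (hu : Summable fun n : ℕ => Real.exp (-(l * (n + 1 : ℝ))) • (B ^ (n + 1)) J) :
    Real.exp l • ∑' n : ℕ, Real.exp (-(l * (n + 1 : ℝ))) • (B ^ (n + 1)) J =
      B ((∑' n : ℕ, Real.exp (-(l * (n + 1 : ℝ))) • (B ^ (n + 1)) J) + J) := by
  have hv : Summable fun n : ℕ => Real.exp l • Real.exp (-(l * (n + 1 : ℝ))) • (B ^ (n + 1)) J :=
    hu.const_smul _
  rw [← hu.tsum_const_smul, hv.tsum_eq_zero_add, map_add, B.map_tsum hu, add_comm]
  congr 1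
  · refine tsum_congr fun n => ?_
    rw [map_smul, smul_smul, ← Real.exp_add, pow_succ' B (n + 1), mul_apply_eq_comp]
    congr 2
    push_cast
    ring
  · simp [smul_smul, ← Real.exp_add]

/-- Multiplying a primitive of a bounded function by an exponential gives a Lipschitz function. -/
theorem lipschitzOnWith_exp_smul_add_integral {h : ℝ → E} (hh : IntervalIntegrable h volume 0 1)
    {M : ℝ} (hM : ∀ t ∈ Set.Icc (0:ℝ) 1, ‖h t‖ ≤ M) (l : ℝ) (W : E) :
    ∃ K : ℝ≥0, LipschitzOnWith K (fun s => Real.exp (l * s) • (W + ∫ t in s..1, h t))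
      (Set.Icc (0:ℝ) 1) := by
  have hM0 : 0 ≤ M := (norm_nonneg _).trans (hM 0 (by simp))
  have hbd : ∀ x ∈ Set.Icc (0:ℝ) 1, ∀ y ∈ Set.Icc (0:ℝ) 1,
      ‖∫ t in x..y, h t‖ ≤ M * |y - x| := fun x hx y hy =>
    intervalIntegral.norm_integral_le_of_norm_le_const fun t ht =>
      hM t (Set.uIcc_subset_Icc hx hy (Set.uIoc_subset_uIcc ht))
  have hexp : ∀ x ∈ Set.Icc (0:ℝ) 1, Real.exp (l * x) ≤ Real.exp |l| := fun x hx => by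
    rw [Real.exp_le_exp]
    nlinarith [le_abs_self l, abs_nonneg l, hx.1, hx.2]
  refine ⟨Real.toNNReal (|l| * Real.exp |l| * (‖W‖ + M) + Real.exp |l| * M),
    LipschitzOnWith.of_dist_le_mul fun x hx y hy => ?_⟩
  rw [Real.coe_toNNReal _ (by positivity), dist_eq_norm, Real.dist_eq]
  have hexp_sub : |Real.exp (l * x) - Real.exp (l * y)| ≤ |l| * Real.exp |l| * |x - y| := by
    refine (convex_Icc (0:ℝ) 1).norm_image_sub_le_of_norm_hasDerivWithin_le
      (f := fun x => Real.exp (l * x)) (f' := fun x => Real.exp (l * x) * l)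
      (fun z _ => ?_) (fun z hz => ?_) hy hx
    · simpa using ((hasDerivAt_id z).const_mul l).exp.hasDerivWithinAt
    · rw [norm_mul, Real.norm_eq_abs, Real.norm_eq_abs, Real.abs_exp, mul_comm]
      exact mul_le_mul_of_nonneg_left (hexp z hz) (abs_nonneg l)
  have hint : ∀ a ∈ Set.Icc (0:ℝ) 1, ∀ b ∈ Set.Icc (0:ℝ) 1, IntervalIntegrable h volume a b :=
    fun a ha b hb => hh.mono_set (by
      rw [Set.uIcc_of_le zero_le_one]; exact Set.uIcc_subset_Icc ha hb)
  have h1 : (1:ℝ) ∈ Set.Icc (0:ℝ) 1 := by simp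
  have hsplit : Real.exp (l * x) • (W + ∫ t in x..1, h t) -
      Real.exp (l * y) • (W + ∫ t in y..1, h t) =
      (Real.exp (l * x) - Real.exp (l * y)) • (W + ∫ t in x..1, h t) +
        Real.exp (l * y) • ∫ t in x..y, h t := by
    rw [← intervalIntegral.integral_add_adjacent_intervals (hint x hx y hy) (hint y hy 1 h1)]
    module
  have hW : ‖W + ∫ t in x..1, h t‖ ≤ ‖W‖ + M := by
    refine (norm_add_le _ _).trans (add_le_add_right ((hbd x hx 1 h1).trans ?_) _)
    rw [abs_of_nonneg (by linarith [hx.2])]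
    nlinarith [hx.1]
  rw [hsplit]
  calc _ ≤ |Real.exp (l * x) - Real.exp (l * y)| * ‖W + ∫ t in x..1, h t‖ +
        Real.exp (l * y) * ‖∫ t in x..y, h t‖ := by
        refine (norm_add_le _ _).trans (le_of_eq ?_)
        rw [norm_smul, norm_smul, Real.norm_eq_abs, Real.norm_eq_abs, Real.abs_exp]
    _ ≤ |l| * Real.exp |l| * |x - y| * (‖W‖ + M) + Real.exp |l| * (M * |x - y|) := by
        rw [abs_sub_comm x y] at *
        gcongr ?_ * ?_ + ?_ * ?_
        · exact hexp y hy
        · exact hbd x hx y hy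
    _ = _ := by ring

variable [CompleteSpace E]

/-- The `n`-th term of the resolvent series is `exp (l s)` times the image under
`(exp (-l) B) ^ (n + 1)` of the Laplace transform of `f` over `[0,1]`. -/
theorem resolvent_term_eq (B : E →L[ℝ] E) {f : ℝ → E} {l : ℝ}
    (hf : IntervalIntegrable (fun t => Real.exp (-(l * t)) • f t) volume 0 1) (n : ℕ) (s : ℝ) :
    Real.exp (-(l * n)) •
        ∫ t in Set.Icc (0:ℝ) 1, Real.exp (-(l * (t + 1 - s))) • (B ^ (n + 1)) (f t) =
      Real.exp (l * s) • ((Real.exp (-(l * (n + 1 : ℝ))) • (B ^ (n + 1))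
        (∫ t in (0:ℝ)..1, Real.exp (-(l * t)) • f t))) := by
  have hint : ∀ t : ℝ, Real.exp (-(l * (t + 1 - s))) • (B ^ (n + 1)) (f t) =
      Real.exp (l * s - l) • (B ^ (n + 1)) (Real.exp (-(l * t)) • f t) := fun t => by
    rw [map_smul, smul_smul, ← Real.exp_add]
    ring_nf
  simp_rw [hint]
  rw [integral_smul, integral_Icc_eq_integral_Ioc, ← intervalIntegral.integral_of_le zero_le_one,
    (B ^ (n + 1)).intervalIntegral_comp_comm hf, smul_smul, smul_smul, ← Real.exp_add,
    ← Real.exp_add]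
  ring_nf

theorem ae_hasDerivAt_exp_smul_add_integral {f : ℝ → E} {l : ℝ}
    (hh : IntervalIntegrable (fun t => Real.exp (-(l * t)) • f t) volume 0 1) (W : E) :
    ∀ᵐ s ∂(volume : Measure ℝ), s ∈ Set.Ioo (0:ℝ) 1 →
      HasDerivAt (fun s => Real.exp (l * s) • (W + ∫ t in s..1, Real.exp (-(l * t)) • f t))
        (l • (Real.exp (l * s) • (W + ∫ t in s..1, Real.exp (-(l * t)) • f t)) - f s) s := by
  filter_upwards [hh.ae_hasDerivAt_integral] with s hs hs'
  have hd := hs (by rw [Set.uIcc_of_le zero_le_one]; exact Set.Ioo_subset_Icc_self hs') 1 (by simp)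
  have he : HasDerivAt (fun s => Real.exp (l * s)) (Real.exp (l * s) * l) s := by
    simpa using ((hasDerivAt_id s).const_mul l).exp
  have hF := he.smul (hd.neg.const_add W)
  simp only [Pi.neg_apply, ← intervalIntegral.integral_symm] at hF
  refine hF.congr_deriv ?_
  rw [smul_neg, smul_smul, ← Real.exp_add, add_neg_cancel, Real.exp_zero, one_smul, smul_smul,
    mul_comm _ l, neg_add_eq_sub]

end ResolventFormula

/-- Let `B` be the operator on real `ℓ¹` induced by a column-stochastic
matrix `b`, `λ > 0` and `f : [0,1] → ℓ¹` bounded and strongly measurable. If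
`g(s) = ∑_{n=0}^∞ e^{−λn} ∫₀¹ e^{−λ(t+1−s)} B^{n+1}(f(t)) dt + ∫_s¹ e^{λ(s−t)} f(t) dt`
(the series converging absolutely for every `s ∈ [0,1]`), then `g` is Lipschitz on
`[0,1]`, `g(1) = B(g(0))`, and for a.e. `s ∈ (0,1)` the function `g` is differentiable at
`s` with `g′(s) = λ g(s) − f(s)`. (Thus `g = R(λ, A) f` for the generator `A = d/dx` of
the flow semigroup on `L^∞([0,1]; ℓ¹)`.) -/
theorem resolvent_formula_flow_generator
    (b : ℕ → ℕ → ℝ) (hb_nonneg : ∀ i j, 0 ≤ b i j)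
    (hb_colsum : ∀ j, HasSum (fun i => b i j) (1 : ℝ))
    (B : lp (fun _ : ℕ => ℝ) 1 →L[ℝ] lp (fun _ : ℕ => ℝ) 1)
    (hB : ∀ (x : lp (fun _ : ℕ => ℝ) 1) (i : ℕ), B x i = ∑' j, b i j * x j)
    (l : ℝ) (hl : 0 < l)
    (f : ℝ → lp (fun _ : ℕ => ℝ) 1) (hf_meas : StronglyMeasurable f)
    (hf_bdd : ∃ C : ℝ, ∀ t ∈ Set.Icc (0:ℝ) 1, ‖f t‖ ≤ C)
    (g : ℝ → lp (fun _ : ℕ => ℝ) 1)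
    (hsum : ∀ s ∈ Set.Icc (0:ℝ) 1, Summable (fun n : ℕ =>
      ‖Real.exp (-(l * n)) •
        ∫ t in Set.Icc (0:ℝ) 1, Real.exp (-(l * (t + 1 - s))) • (B ^ (n + 1)) (f t)‖))
    (hg : ∀ s ∈ Set.Icc (0:ℝ) 1, g s =
      (∑' n : ℕ, Real.exp (-(l * n)) •
        ∫ t in Set.Icc (0:ℝ) 1, Real.exp (-(l * (t + 1 - s))) • (B ^ (n + 1)) (f t)) +
      ∫ t in Set.Icc s 1, Real.exp (l * (s - t)) • f t) :
    (∃ K : ℝ≥0, LipschitzOnWith K g (Set.Icc (0:ℝ) 1)) ∧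
    g 1 = B (g 0) ∧
    (∀ᵐ s ∂(volume : Measure ℝ), s ∈ Set.Ioo (0:ℝ) 1 →
      HasDerivAt g (l • g s - f s) s) := by
  obtain ⟨C, hC⟩ := hf_bdd
  have hh := intervalIntegrable_exp_smul_of_bounded hf_meas hC l
  simp_rw [resolvent_term_eq B hh] at hsum hg
  set h : ℝ → lp (fun _ : ℕ => ℝ) 1 := fun t => Real.exp (-(l * t)) • f t with hh_def
  set u : ℕ → lp (fun _ : ℕ => ℝ) 1 := fun n =>
    Real.exp (-(l * (n + 1 : ℝ))) • (B ^ (n + 1)) (∫ t in (0:ℝ)..1, h t) with hu_def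
  have hu : Summable u := by
    simpa [hu_def] using (hsum 0 (by simp)).of_norm
  have hg' : ∀ s ∈ Set.Icc (0:ℝ) 1, g s = Real.exp (l * s) • ((∑' n, u n) + ∫ t in s..1, h t) :=
    fun s hs => by
      rw [hg s hs, setIntegral_Icc_exp_smul_eq f l hs.2, hu.tsum_const_smul, smul_add]
  have hhC : ∀ t ∈ Set.Icc (0:ℝ) 1, ‖h t‖ ≤ C := fun t ht => by
    rw [hh_def, norm_smul, Real.norm_eq_abs, Real.abs_exp]
    refine (mul_le_of_le_one_left (norm_nonneg _) ?_).trans (hC t ht)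
    rw [Real.exp_le_one_iff]
    nlinarith [ht.1]
  refine ⟨?_, ?_, ?_⟩
  · obtain ⟨K, hK⟩ := lipschitzOnWith_exp_smul_add_integral hh hhC l (∑' n, u n)
    exact ⟨K, fun x hx y hy => by simpa only [hg' x hx, hg' y hy] using hK hx hy⟩
  · rw [hg' 1 (by simp), hg' 0 (by simp)]
    simpa only [mul_one, mul_zero, Real.exp_zero, one_smul, intervalIntegral.integral_same,
      add_zero] using exp_smul_tsum_eq_map_tsum_add B l _ hu
  · filter_upwards [ae_hasDerivAt_exp_smul_add_integral hh (∑' n, u n)] with s hs hs'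
    rw [hg' s (Set.Ioo_subset_Icc_self hs')]
    refine (hs hs').congr_of_eventuallyEq ?_
    filter_upwards [Icc_mem_nhds hs'.1 hs'.2] with r hr using hg' r hr
end

section
/- Let b : ℕ → ℕ → ℝ be a column-stochastic matrix (b i j ≥ 0, ∑_i b i j = 1 for all j) inducing the bounded operator B on the complex sequence space ℓ¹ = ℓ¹(ℕ;ℂ), and let λ ∈ ℂ. Then the following are equivalent: (i) there exists v ∈ ℓ¹ with v ≠ 0 and B v = e^λ · v; (ii) there exists a function f : ℝ → ℓ¹ with f(0) ≠ 0 such that f has derivative λ·f(s) at every s ∈ [0,1] (i.e. HasDerivAt f (λ • f s) s for all s ∈ [0,1]) and f(1) = B(f(0)). (This is the characteristic equation: λ is an eigenvalue of the generator A = d/dx with boundary condition f(1) = B f(0) of the flow semigroup if and only if e^λ is an eigenvalue of B.) -/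
open scoped ENNReal

theorem hasDerivAt_cexp_mul_ofReal (l : ℂ) (s : ℝ) :
    HasDerivAt (fun t : ℝ => Complex.exp (l * t)) (l * Complex.exp (l * s)) s := by
  have h : HasDerivAt (fun t : ℝ => l * (t : ℂ)) (l * 1) s :=
    (Complex.ofRealCLM.hasDerivAt (x := s)).const_mul l
  simpa [mul_comm] using h.cexp

/-- A solution of `f' = l • f` on `[0, 1]` satisfies `f 1 = exp l • f 0`. -/
theorem eq_cexp_smul_of_hasDerivAt_smul {E : Type*} [NormedAddCommGroup E] [NormedSpace ℂ E]
    {l : ℂ} {f : ℝ → E} (hf : ∀ s ∈ Set.Icc (0 : ℝ) 1, HasDerivAt f (l • f s) s) :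
    f 1 = Complex.exp l • f 0 := by
  have hg : ∀ s ∈ Set.Icc (0 : ℝ) 1,
      HasDerivAt (fun t : ℝ => Complex.exp (-l * t) • f t) 0 s := by
    intro s hs
    refine ((hasDerivAt_cexp_mul_ofReal (-l) s).smul (hf s hs)).congr_deriv ?_
    module
  have h := constant_of_has_deriv_right_zero
    (fun s hs => (hg s hs).continuousAt.continuousWithinAt)
    (fun s hs => (hg s (Set.Ico_subset_Icc_self hs)).hasDerivWithinAt) 1 (by simp)
  have h' : Complex.exp (-l) • f 1 = f 0 := by simpa using h
  rw [← h', smul_smul, ← Complex.exp_add, add_neg_cancel, Complex.exp_zero, one_smul]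

/-- **characteristic equation.** Let `B` be the operator on complex `ℓ¹`
induced by a column-stochastic matrix `b` and let `λ ∈ ℂ`. Then `e^λ` is an eigenvalue of
`B` if and only if there is a function `f : ℝ → ℓ¹` with `f(0) ≠ 0` satisfying
`f′(s) = λ f(s)` for every `s ∈ [0,1]` and the boundary condition `f(1) = B(f(0))`;
i.e. `λ` is an eigenvalue of the generator `A = d/dx` with boundary condition
`f(1) = B f(0)` of the flow semigroup iff `e^λ` is an eigenvalue of `B`. -/
theorem characteristic_equation_point_spectrum
    (b : ℕ → ℕ → ℝ) (hb_nonneg : ∀ i j, 0 ≤ b i j)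
    (hb_colsum : ∀ j, HasSum (fun i => b i j) (1 : ℝ))
    (B : lp (fun _ : ℕ => ℂ) 1 →L[ℂ] lp (fun _ : ℕ => ℂ) 1)
    (hB : ∀ (x : lp (fun _ : ℕ => ℂ) 1) (i : ℕ), B x i = ∑' j, (b i j : ℂ) * x j)
    (l : ℂ) :
    (∃ v : lp (fun _ : ℕ => ℂ) 1, v ≠ 0 ∧ B v = Complex.exp l • v) ↔
    (∃ f : ℝ → lp (fun _ : ℕ => ℂ) 1, f 0 ≠ 0 ∧
      (∀ s ∈ Set.Icc (0:ℝ) 1, HasDerivAt f (l • f s) s) ∧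
      f 1 = B (f 0)) := by
  constructor
  · rintro ⟨v, hv, hBv⟩
    refine ⟨fun s => Complex.exp (l * s) • v, by simpa using hv, fun s _ => ?_, by simp [hBv]⟩
    simpa only [smul_smul] using (hasDerivAt_cexp_mul_ofReal l s).smul_const v
  · rintro ⟨f, hf0, hf, hf1⟩
    exact ⟨f 0, hf0, hf1.symm.trans (eq_cexp_smul_of_hasDerivAt_smul hf)⟩
end

section
/- Let b : ℕ → ℕ → ℝ be a column-stochastic matrix (b i j ≥ 0, ∑_i b i j = 1 for all j) inducing the bounded operator B on ℓ¹ = ℓ¹(ℕ;ℝ). Let μ be an ℓ¹-valued vector measure on the Borel σ-algebra of ℝ (a σ-additive set function with μ(∅) = 0) that is concentrated on [0,1], i.e. μ(A) = μ(A ∩ [0,1]) for every Borel set A. For t ≥ 0 set n := ⌊t⌋ and let S(t)μ be the ℓ¹-valued vector measure given for Borel A ⊆ ℝ by (S(t)μ)(A) = Bⁿ( μ((A + (t−n)) ∩ [t−n, 1]) ) + B^{n+1}( μ((A − (n+1−t)) ∩ [0, t−n)) ) (this is a well-defined vector measure, obtained from μ by restriction, pushforward under translation, and composition with powers of B). Then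 S(t) is contractive for the total variation: for every finite family A₁, …, A_N of pairwise disjoint Borel subsets of [0,1], ∑_{k=1}^N ‖(S(t)μ)(A_k)‖ ≤ sup { ∑_{l=1}^M ‖μ(C_l)‖ : M ∈ ℕ, C₁, …, C_M pairwise disjoint Borel subsets of ℝ }, the supremum being taken in [0,∞]. -/
open MeasureTheory
open scoped ENNReal NNReal

/-- An operator on `ℓ¹` given by a column-stochastic matrix is a contraction. -/
theorem norm_apply_le_of_column_stochastic
    {b : ℕ → ℕ → ℝ} (hb_nonneg : ∀ i j, 0 ≤ b i j)
    (hb_colsum : ∀ j, HasSum (fun i => b i j) (1 : ℝ))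
    {B : lp (fun _ : ℕ => ℝ) 1 →L[ℝ] lp (fun _ : ℕ => ℝ) 1}
    (hB : ∀ (x : lp (fun _ : ℕ => ℝ) 1) (i : ℕ), B x i = ∑' j, b i j * x j)
    (x : lp (fun _ : ℕ => ℝ) 1) : ‖B x‖ ≤ ‖x‖ := by
  have hx : HasSum (fun j => ‖x j‖) ‖x‖ := by
    simpa using lp.hasSum_norm (p := 1) (by norm_num) x
  have hle : ∀ (s : Finset ℕ) (j : ℕ), ∑ i ∈ s, b i j ≤ 1 := fun s j =>
    sum_le_hasSum s (fun i _ => hb_nonneg i j) (hb_colsum j)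
  have hsum : ∀ i, Summable fun j => b i j * ‖x j‖ := fun i =>
    Summable.of_nonneg_of_le (fun j => mul_nonneg (hb_nonneg i j) (norm_nonneg _))
      (fun j => mul_le_of_le_one_left (norm_nonneg _) (by simpa using hle {i} j)) hx.summable
  refine lp.norm_le_of_forall_sum_le (p := 1) (by norm_num) (norm_nonneg x) fun s => ?_
  simp only [ENNReal.toReal_one, Real.rpow_one]
  calc ∑ i ∈ s, ‖B x i‖ ≤ ∑ i ∈ s, ∑' j, b i j * ‖x j‖ := by
        refine Finset.sum_le_sum fun i _ => ?_
        have hnorm : (fun j => ‖b i j * x j‖) = fun j => b i j * ‖x j‖ := by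
          funext j
          rw [norm_mul, Real.norm_of_nonneg (hb_nonneg i j)]
        rw [hB, ← hnorm]
        exact norm_tsum_le_tsum_norm (hnorm ▸ hsum i)
    _ = ∑' j, ∑ i ∈ s, b i j * ‖x j‖ := (Summable.tsum_finsetSum fun i _ => hsum i).symm
    _ ≤ ∑' j, ‖x j‖ := by
        refine (summable_sum fun i _ => hsum i).tsum_le_tsum (fun j => ?_) hx.summable
        rw [← Finset.sum_mul]
        exact mul_le_of_le_one_left (norm_nonneg _) (hle s j)
    _ = ‖x‖ := hx.tsum_eq

/-- Powers of a contraction are contractions. -/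
theorem ContinuousLinearMap.norm_pow_apply_le_of_norm_apply_le
    {E : Type*} [NormedAddCommGroup E] [NormedSpace ℝ E]
    {T : E →L[ℝ] E} (hT : ∀ x, ‖T x‖ ≤ ‖x‖) (n : ℕ) (x : E) : ‖(T ^ n) x‖ ≤ ‖x‖ := by
  induction n with
  | zero => simp
  | succ n ih =>
    rw [pow_succ']
    exact (hT _).trans ih

/-- A sum of norms over a finite disjoint measurable family is at most the total variation. -/
theorem MeasureTheory.VectorMeasure.sum_nnnorm_le_iSup
    {α E : Type*} [MeasurableSpace α] [NormedAddCommGroup E] (μ : VectorMeasure α E)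
    {ι : Type*} [Fintype ι] (P : ι → Set α) (hP : ∀ i, MeasurableSet (P i))
    (hd : Pairwise (Function.onFun Disjoint P)) :
    ∑ i, (‖μ (P i)‖₊ : ℝ≥0∞) ≤
      ⨆ (M : ℕ) (C : Fin M → Set α) (_ : ∀ l, MeasurableSet (C l))
        (_ : Pairwise (Function.onFun Disjoint C)), ∑ l : Fin M, (‖μ (C l)‖₊ : ℝ≥0∞) := by
  let e := (Fintype.equivFin ι).symm
  refine le_iSup_of_le (Fintype.card ι) <| le_iSup_of_le (P ∘ e) <|
    le_iSup_of_le (fun l => hP (e l)) <|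
    le_iSup_of_le (fun i j hij => hd (e.injective.ne hij)) ?_
  exact (e.sum_comp fun i => (‖μ (P i)‖₊ : ℝ≥0∞)).ge

/-- Let `B` be the operator on real `ℓ¹` induced by a column-stochastic
matrix `b` and let `μ` be an `ℓ¹`-valued vector measure on the Borel sets of `ℝ`
concentrated on `[0,1]`. For `t ≥ 0` with `n = ⌊t⌋`, the extended flow
`(S(t)μ)(A) = Bⁿ(μ((A + (t−n)) ∩ [t−n,1])) + B^{n+1}(μ((A − (n+1−t)) ∩ [0,t−n)))` is
contractive for the total variation: for any finite disjoint family of Borel subsets of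
`[0,1]`, the sum of the norms of the values of `S(t)μ` is at most the total variation of
`μ`. -/
theorem extended_flow_contractive_total_variation
    (b : ℕ → ℕ → ℝ) (hb_nonneg : ∀ i j, 0 ≤ b i j)
    (hb_colsum : ∀ j, HasSum (fun i => b i j) (1 : ℝ))
    (B : lp (fun _ : ℕ => ℝ) 1 →L[ℝ] lp (fun _ : ℕ => ℝ) 1)
    (hB : ∀ (x : lp (fun _ : ℕ => ℝ) 1) (i : ℕ), B x i = ∑' j, b i j * x j)
    (μ : VectorMeasure ℝ (lp (fun _ : ℕ => ℝ) 1))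
    (hconc : ∀ A : Set ℝ, MeasurableSet A → μ A = μ (A ∩ Set.Icc (0:ℝ) 1))
    (t : ℝ) (ht : 0 ≤ t) :
    ∀ (N : ℕ) (A : Fin N → Set ℝ),
      (∀ k, MeasurableSet (A k)) → (∀ k, A k ⊆ Set.Icc (0:ℝ) 1) →
      Pairwise (Function.onFun Disjoint A) →
      ∑ k : Fin N,
        (‖(B ^ (Nat.floor t))
            (μ ((fun a => a + (t - (Nat.floor t : ℝ))) '' (A k) ∩
              Set.Icc (t - (Nat.floor t : ℝ)) 1)) +
          (B ^ (Nat.floor t + 1))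
            (μ ((fun a => a - ((Nat.floor t : ℝ) + 1 - t)) '' (A k) ∩
              Set.Ico (0:ℝ) (t - (Nat.floor t : ℝ))))‖₊ : ℝ≥0∞) ≤
      ⨆ (M : ℕ) (C : Fin M → Set ℝ) (_ : ∀ l, MeasurableSet (C l))
        (_ : Pairwise (Function.onFun Disjoint C)),
        ∑ l : Fin M, (‖μ (C l)‖₊ : ℝ≥0∞) := by
  intro N A hA _ hd
  set n := Nat.floor t
  set s : ℝ := t - n
  have hcontr := ContinuousLinearMap.norm_pow_apply_le_of_norm_apply_le
    (norm_apply_le_of_column_stochastic hb_nonneg hb_colsum hB)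
  let P : Fin N → Set ℝ := fun k => (fun a => a + s) '' A k ∩ Set.Icc s 1
  let Q : Fin N → Set ℝ := fun k => (fun a => a - ((n : ℝ) + 1 - t)) '' A k ∩ Set.Ico 0 s
  have hP : ∀ k, MeasurableSet (P k) := fun k =>
    ((measurableEmbedding_addRight s).measurableSet_image.2 (hA k)).inter measurableSet_Icc
  have hQ : ∀ k, MeasurableSet (Q k) := fun k =>
    ((measurableEmbedding_subRight _).measurableSet_image.2 (hA k)).inter measurableSet_Ico
  have hPQ : ∀ k l, Disjoint (P k) (Q l) := fun k l =>
    Set.disjoint_left.2 fun _ hx hy => not_lt.2 hx.2.1 hy.2.2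
  have hdisj : Pairwise (Function.onFun Disjoint (Sum.elim P Q)) := by
    rintro (k | k) (l | l) hkl
    · exact ((Set.disjoint_image_iff (add_left_injective s)).2
        (hd fun h => hkl (congrArg _ h))).mono Set.inter_subset_left Set.inter_subset_left
    · exact hPQ k l
    · exact (hPQ l k).symm
    · exact ((Set.disjoint_image_iff sub_left_injective).2
        (hd fun h => hkl (congrArg _ h))).mono Set.inter_subset_left Set.inter_subset_left
  calc ∑ k, (‖(B ^ n) (μ (P k)) + (B ^ (n + 1)) (μ (Q k))‖₊ : ℝ≥0∞)
      ≤ ∑ k, ((‖μ (P k)‖₊ : ℝ≥0∞) + ‖μ (Q k)‖₊) :=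
        Finset.sum_le_sum fun k _ => mod_cast
          (nnnorm_add_le _ _).trans (add_le_add (hcontr n _) (hcontr (n + 1) _))
    _ = ∑ i, (‖μ (Sum.elim P Q i)‖₊ : ℝ≥0∞) := by
        rw [Fintype.sum_sum_type, Finset.sum_add_distrib]
        rfl
    _ ≤ _ := μ.sum_nnnorm_le_iSup _ (Sum.rec hP hQ) hdisj
end

section
/- Let b : ℕ → ℕ → ℝ be a column-stochastic matrix (b i j ≥ 0, ∑_i b i j = 1 for all j) inducing the bounded operator B on ℓ¹ = ℓ¹(ℕ;ℝ), let f ∈ L¹([0,1];ℓ¹) (Lebesgue measure restricted to [0,1]), let t ≥ 0 and set n := ⌊t⌋. Then for every Borel set A ⊆ [0,1] one has the identity of Bochner integrals ∫_A B^{⌊s+t⌋}( f(s + t − ⌊s+t⌋) ) ds = Bⁿ( ∫_{(A + (t−n)) ∩ [t−n, 1]} f(s) ds ) + B^{n+1}( ∫_{(A − (n+1−t)) ∩ [0, t−n)} f(s) ds ). (In other words, the vector measure with density T(t)f with respect to Lebesgue measure, where T is the network flow semigroup on L¹([0,1];ℓ¹), coincides with S(t) applied to the vector measure with density f; i.e.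 the extended flow semigroup on vector measures extends the flow semigroup on L¹.) -/
open MeasureTheory
open scoped ENNReal

/-- The map `s ↦ L (f (s + c))` is integrable on `P` and its integral is `L` applied to the integral of `f` over the
translate of `P`. -/
lemma integrableOn_and_setIntegral_clm_comp_add_right {E F : Type*}
    [NormedAddCommGroup E] [NormedSpace ℝ E] [CompleteSpace E]
    [NormedAddCommGroup F] [NormedSpace ℝ F] [CompleteSpace F]
    (L : E →L[ℝ] F) (f : ℝ → E) (c : ℝ) (P : Set ℝ)
    (hf : IntegrableOn f ((fun a => a + c) '' P)) :
    IntegrableOn (fun s => L (f (s + c))) P ∧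
      ∫ s in P, L (f (s + c)) = L (∫ s in (fun a => a + c) '' P, f s) := by
  have hmp : MeasurePreserving (fun a : ℝ => a + c) := measurePreserving_add_right volume c
  have hemb : MeasurableEmbedding (fun a : ℝ => a + c) := measurableEmbedding_addRight c
  have hint : IntegrableOn (fun s => f (s + c)) P :=
    (hmp.integrableOn_image hemb).1 hf
  refine ⟨L.integrable_comp hint, ?_⟩
  rw [L.integral_comp_comm hint, hmp.setIntegral_image_emb hemb]

/-- Let `B` be the operator on real `ℓ¹` induced by a column-stochastic
matrix `b`, let `f ∈ L¹([0,1]; ℓ¹)`, `t ≥ 0` and `n = ⌊t⌋`. Then for every Borel set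
`A ⊆ [0,1]`,
`∫_A B^⌊s+t⌋ f(s+t−⌊s+t⌋) ds
  = Bⁿ(∫_{(A+(t−n)) ∩ [t−n,1]} f) + B^{n+1}(∫_{(A−(n+1−t)) ∩ [0,t−n)} f)`;
i.e. the vector measure with density `T(t)f` (with `T` the network flow semigroup on
`L¹([0,1]; ℓ¹)`) coincides with the extended flow `S(t)` applied to the vector measure with
density `f`. -/
theorem extended_flow_extends_L1_flow
    (b : ℕ → ℕ → ℝ) (hb_nonneg : ∀ i j, 0 ≤ b i j)
    (hb_colsum : ∀ j, HasSum (fun i => b i j) (1 : ℝ))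
    (B : lp (fun _ : ℕ => ℝ) 1 →L[ℝ] lp (fun _ : ℕ => ℝ) 1)
    (hB : ∀ (x : lp (fun _ : ℕ => ℝ) 1) (i : ℕ), B x i = ∑' j, b i j * x j)
    (f : ℝ → lp (fun _ : ℕ => ℝ) 1) (hf : IntegrableOn f (Set.Icc (0:ℝ) 1))
    (t : ℝ) (ht : 0 ≤ t)
    (A : Set ℝ) (hA : MeasurableSet A) (hA' : A ⊆ Set.Icc (0:ℝ) 1) :
    ∫ s in A, (B ^ (Nat.floor (s + t))) (f (s + t - (Nat.floor (s + t) : ℝ))) =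
      (B ^ (Nat.floor t))
        (∫ s in ((fun a => a + (t - (Nat.floor t : ℝ))) '' A ∩
          Set.Icc (t - (Nat.floor t : ℝ)) 1), f s) +
      (B ^ (Nat.floor t + 1))
        (∫ s in ((fun a => a - ((Nat.floor t : ℝ) + 1 - t)) '' A ∩
          Set.Ico (0:ℝ) (t - (Nat.floor t : ℝ))), f s) := by
  set n := Nat.floor t with hn
  have hnt : (n : ℝ) ≤ t := Nat.floor_le ht
  have htn : t < n + 1 := Nat.lt_floor_add_one t
  set P : Set ℝ := A ∩ Set.Ico 0 (n + 1 - t) with hP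
  set Q : Set ℝ := A ∩ Set.Icc (n + 1 - t) 1 with hQ
  have hAPQ : A = P ∪ Q := by
    ext x
    constructor
    · intro hx
      rcases lt_or_ge x (n + 1 - t) with h | h
      · exact Or.inl ⟨hx, (hA' hx).1, h⟩
      · exact Or.inr ⟨hx, h, (hA' hx).2⟩
    · rintro (h | h) <;> exact h.1
  have hdisj : Disjoint P Q :=
    Set.disjoint_left.2 fun x hx hy => absurd hx.2.2 (not_lt.2 hy.2.1)
  have hPm : MeasurableSet P := hA.inter measurableSet_Ico
  have hQm : MeasurableSet Q := hA.inter measurableSet_Icc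
  have himP : (fun a => a + (t - n)) '' P =ᵐ[volume]
      ((fun a => a + (t - n)) '' A ∩ Set.Icc (t - n) 1 : Set ℝ) := by
    have : (fun a => a + (t - n)) '' P = (fun a => a + (t - n)) '' A ∩ Set.Ico (t - n) 1 := by
      rw [hP, Set.image_inter (add_left_injective _), Set.image_add_const_Ico]
      congr 2 <;> ring
    rw [this]
    exact Filter.EventuallyEq.rfl.inter Ico_ae_eq_Icc
  have himQ : (fun a => a + (-(n + 1 - t))) '' Q =ᵐ[volume]
      ((fun a => a - (n + 1 - t)) '' A ∩ Set.Ico 0 (t - n) : Set ℝ) := by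
    have : (fun a => a + (-(n + 1 - t))) '' Q =
        (fun a => a - (n + 1 - t)) '' A ∩ Set.Icc 0 (t - n) := by
      simp only [sub_eq_add_neg _ ((n : ℝ) + 1 - t)]
      rw [hQ, Set.image_inter (add_left_injective _), Set.image_add_const_Icc]
      congr 2 <;> ring
    rw [this]
    exact Filter.EventuallyEq.rfl.inter Ico_ae_eq_Icc.symm
  have hfP : IntegrableOn f ((fun a => a + (t - n)) '' P) := by
    refine hf.mono_set ?_
    rintro _ ⟨x, hx, rfl⟩
    have h1 := hx.2.1
    have h2 := hx.2.2
    constructor <;> dsimp only <;> linarith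
  have hfQ : IntegrableOn f ((fun a => a + (-(n + 1 - t))) '' Q) := by
    refine hf.mono_set ?_
    rintro _ ⟨x, hx, rfl⟩
    have h1 := hx.2.1
    have h2 := hx.2.2
    constructor <;> dsimp only <;> linarith
  obtain ⟨hiP, heP⟩ := integrableOn_and_setIntegral_clm_comp_add_right (B ^ n) f _ P hfP
  obtain ⟨hiQ, heQ⟩ := integrableOn_and_setIntegral_clm_comp_add_right (B ^ (n + 1)) f _ Q hfQ
  have hgP : Set.EqOn (fun s => (B ^ n) (f (s + (t - n))))
      (fun s => (B ^ (Nat.floor (s + t))) (f (s + t - (Nat.floor (s + t) : ℝ)))) P := by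
    intro s hs
    have h1 := hs.2.1
    have h2 := hs.2.2
    have hfl : Nat.floor (s + t) = n :=
      (Nat.floor_eq_iff (by linarith)).2 ⟨by linarith, by linarith⟩
    simp only [hfl, add_sub_assoc]
  have hgQ : Set.EqOn (fun s => (B ^ (n + 1)) (f (s + (-(n + 1 - t)))))
      (fun s => (B ^ (Nat.floor (s + t))) (f (s + t - (Nat.floor (s + t) : ℝ)))) Q := by
    intro s hs
    have h1 := hs.2.1
    have h2 := hs.2.2
    have hfl : Nat.floor (s + t) = n + 1 :=
      (Nat.floor_eq_iff (by linarith)).2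
        ⟨by push_cast; linarith, by push_cast; linarith⟩
    have harg : s + (-(n + 1 - t)) = s + t - ((n + 1 : ℕ) : ℝ) := by push_cast; ring
    simp only [hfl, harg]
  rw [← setIntegral_congr_set himP, ← setIntegral_congr_set himQ, ← heP, ← heQ,
    setIntegral_congr_fun hPm hgP, setIntegral_congr_fun hQm hgQ,
    ← setIntegral_union hdisj hQm (hiP.congr_fun hgP hPm) (hiQ.congr_fun hgQ hQm), ← hAPQ]
end
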